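/- Let u, v : ℝ³ → ℝ³ be twice continuously differentiable with ∇·u = 0 and ∇·v = 0, and set ω = ∇×u and J = ∇×v. Then, pointwise on ℝ³, ∇×((u·∇)v − (v·∇)u) = (u·∇)J − (J·∇)u − ((v·∇)ω − (ω·∇)v) − 2 Σⱼ₌₁³ ∇vⱼ × ∇uⱼ, where ∇uⱼ = (∂₁uⱼ, ∂₂uⱼ, ∂₃uⱼ) denotes the gradient of the j-th component and × is the cross product on ℝ³. -/

import Mathlib

/-- Partial derivative in the `j`-th coordinate direction of a scalar function on `ℝ³`. -/
noncomputable def pd (j : Fin 3) (f : (Fin 3 → ℝ) → ℝ) (x : Fin 3 → ℝ) : ℝ :=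
  fderiv ℝ f x (Pi.single j 1)

/-- Curl of a vector field on `ℝ³`. -/
noncomputable def curl (v : (Fin 3 → ℝ) → (Fin 3 → ℝ)) (x : Fin 3 → ℝ) : Fin 3 → ℝ :=
  ![pd 1 (fun y => v y 2) x - pd 2 (fun y => v y 1) x,
    pd 2 (fun y => v y 0) x - pd 0 (fun y => v y 2) x,
    pd 0 (fun y => v y 1) x - pd 1 (fun y => v y 0) x]

/-- Gradient of the `j`-th component of a vector field on `ℝ³`. -/
noncomputable def gradComp (v : (Fin 3 → ℝ) → (Fin 3 → ℝ)) (j : Fin 3) (x : Fin 3 → ℝ) :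
    Fin 3 → ℝ :=
  fun i => pd i (fun y => v y j) x

theorem pd_add {f g : (Fin 3 → ℝ) → ℝ} {x : Fin 3 → ℝ} (j : Fin 3)
    (hf : DifferentiableAt ℝ f x) (hg : DifferentiableAt ℝ g x) :
    pd j (fun y => f y + g y) x = pd j f x + pd j g x := by
  simp [pd, fderiv_fun_add hf hg]

theorem pd_sub {f g : (Fin 3 → ℝ) → ℝ} {x : Fin 3 → ℝ} (j : Fin 3)
    (hf : DifferentiableAt ℝ f x) (hg : DifferentiableAt ℝ g x) :
    pd j (fun y => f y - g y) x = pd j f x - pd j g x := by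
  simp [pd, fderiv_fun_sub hf hg]

theorem pd_mul {f g : (Fin 3 → ℝ) → ℝ} {x : Fin 3 → ℝ} (j : Fin 3)
    (hf : DifferentiableAt ℝ f x) (hg : DifferentiableAt ℝ g x) :
    pd j (fun y => f y * g y) x = f x * pd j g x + g x * pd j f x := by
  simp [pd, fderiv_fun_mul hf hg]

theorem differentiable_pd {f : (Fin 3 → ℝ) → ℝ} (hf : ContDiff ℝ 2 f) (j : Fin 3) :
    Differentiable ℝ (pd j f) :=
  ((hf.fderiv_right (m := 1) (by norm_num)).differentiable (by norm_num)).clm_apply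
    (differentiable_const _)

/-- Symmetry of second partial derivatives. -/
theorem pd_comm {f : (Fin 3 → ℝ) → ℝ} (hf : ContDiff ℝ 2 f) (j k : Fin 3) (x : Fin 3 → ℝ) :
    pd j (pd k f) x = pd k (pd j f) x := by
  have hd : DifferentiableAt ℝ (fderiv ℝ f) x :=
    (hf.fderiv_right (m := 1) (by norm_num)).differentiable (by norm_num) x
  have key (a b : Fin 3) :
      pd a (pd b f) x = fderiv ℝ (fderiv ℝ f) x (Pi.single a 1) (Pi.single b 1) := by
    change fderiv ℝ (fun y => fderiv ℝ f y (Pi.single b 1)) x (Pi.single a 1) = _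
    rw [fderiv_clm_apply hd (differentiableAt_const _)]
    simp
  rw [key, key]
  exact hf.contDiffAt.isSymmSndFDerivAt (by simp) _ _

theorem pd_advection {u : (Fin 3 → ℝ) → (Fin 3 → ℝ)} {f : (Fin 3 → ℝ) → ℝ}
    (hu : ContDiff ℝ 2 u) (hf : ContDiff ℝ 2 f) (i : Fin 3) (x : Fin 3 → ℝ) :
    pd i (fun y => ∑ j : Fin 3, u y j * pd j f y) x
      = ∑ j : Fin 3, (u x j * pd j (pd i f) x + pd j f x * pd i (fun y => u y j) x) := by
  have hc (j : Fin 3) : DifferentiableAt ℝ (fun y => u y j) x :=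
    (contDiff_pi.1 hu j).differentiable (by norm_num) x
  have hp (j : Fin 3) : DifferentiableAt ℝ (pd j f) x := differentiable_pd hf j x
  have hm (j : Fin 3) : DifferentiableAt ℝ (fun y => u y j * pd j f y) x := (hc j).mul (hp j)
  simp only [Fin.sum_univ_three]
  rw [pd_add i ((hm 0).fun_add (hm 1)) (hm 2), pd_add i (hm 0) (hm 1),
    pd_mul i (hc 0) (hp 0), pd_mul i (hc 1) (hp 1), pd_mul i (hc 2) (hp 2),
    pd_comm hf i 0, pd_comm hf i 1, pd_comm hf i 2]

theorem differentiable_advection {u : (Fin 3 → ℝ) → (Fin 3 → ℝ)} {f : (Fin 3 → ℝ) → ℝ}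
    (hu : ContDiff ℝ 2 u) (hf : ContDiff ℝ 2 f) :
    Differentiable ℝ (fun y => ∑ j : Fin 3, u y j * pd j f y) :=
  Differentiable.fun_sum fun j _ =>
    ((contDiff_pi.1 hu j).differentiable (by norm_num)).mul (differentiable_pd hf j)

/-- Curl of the Lie bracket: for divergence-free `u, v` on `ℝ³` with `ω = ∇×u`, `J = ∇×v`,
`∇×((u·∇)v − (v·∇)u) = (u·∇)J − (J·∇)u − ((v·∇)ω − (ω·∇)v) − 2 Σⱼ ∇vⱼ × ∇uⱼ`. -/
theorem curl_lie_bracket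
    (u v : (Fin 3 → ℝ) → (Fin 3 → ℝ)) (hu : ContDiff ℝ 2 u) (hv : ContDiff ℝ 2 v)
    (hdivu : ∀ x : Fin 3 → ℝ, (∑ j : Fin 3, pd j (fun y => u y j) x) = 0)
    (hdivv : ∀ x : Fin 3 → ℝ, (∑ j : Fin 3, pd j (fun y => v y j) x) = 0) :
    ∀ (x : Fin 3 → ℝ) (i : Fin 3),
      curl (fun y => fun k : Fin 3 =>
          (∑ j : Fin 3, u y j * pd j (fun z => v z k) y)
            - ∑ j : Fin 3, v y j * pd j (fun z => u z k) y) x i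
        = ((∑ j : Fin 3, u x j * pd j (fun y => curl v y i) x)
              - ∑ j : Fin 3, curl v x j * pd j (fun y => u y i) x)
          - ((∑ j : Fin 3, v x j * pd j (fun y => curl u y i) x)
              - ∑ j : Fin 3, curl u x j * pd j (fun y => v y i) x)
          - 2 * ∑ j : Fin 3, crossProduct (gradComp v j x) (gradComp u j x) i := by
  intro x i
  have hc {w : (Fin 3 → ℝ) → (Fin 3 → ℝ)} (hw : ContDiff ℝ 2 w) (k : Fin 3) :
      ContDiff ℝ 2 (fun y => w y k) := contDiff_pi.1 hw k
  have hbracket (a k : Fin 3) := pd_sub a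
    (differentiable_advection hu (hc hv k) x) (differentiable_advection hv (hc hu k) x)
  have hcurl {w : (Fin 3 → ℝ) → (Fin 3 → ℝ)} (hw : ContDiff ℝ 2 w) (j a b k l : Fin 3) :=
    pd_sub j (differentiable_pd (hc hw k) a x) (differentiable_pd (hc hw l) b x)
  have h1 := hdivu x
  have h2 := hdivv x
  have hadv_v (a k : Fin 3) := pd_advection hu (hc hv k) a x
  have hadv_u (a k : Fin 3) := pd_advection hv (hc hu k) a x
  simp only [Fin.sum_univ_three] at h1 h2 hbracket hadv_v hadv_u ⊢
  fin_cases i <;>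
    simp [curl, gradComp, cross_apply, hbracket, hadv_v, hadv_u, hcurl hu, hcurl hv]
  · linear_combination (pd 1 (fun y => v y 2) x - pd 2 (fun y => v y 1) x) * h1
      - (pd 1 (fun y => u y 2) x - pd 2 (fun y => u y 1) x) * h2
  · linear_combination (pd 2 (fun y => v y 0) x - pd 0 (fun y => v y 2) x) * h1
      - (pd 2 (fun y => u y 0) x - pd 0 (fun y => u y 2) x) * h2
  · linear_combination (pd 0 (fun y => v y 1) x - pd 1 (fun y => v y 0) x) * h1
      - (pd 0 (fun y => u y 1) x - pd 1 (fun y => u y 0) x) * h2
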